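/- Let f be a probability density function on ℝ that is positive everywhere, strictly log-concave, and has a finite mean, let b ∈ ℝ and N ≥ 2. Define the best-response (Lloyd–Max) map T on the set D = {m ∈ ℝ^{N−1} : m_1 < ⋯ < m_{N−1}} by T_k(m) = (E[M | m_{k−1} ≤ M < m_k] + E[M | m_k ≤ M < m_{k+1}])/2 + b for k = 1, …, N−1, with m_0 = −∞ and m_N = +∞. Then T maps D into D, T has a unique fixed point m* in D, and for every starting point m ∈ D the iterates T^n(m) converge to m* in the sup norm as n → ∞. -/

import Mathlib

open MeasureTheory Set Filter

/-- Conditional mean `E[M | M ∈ s]` of a random variable with density `f`. -/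
noncomputable def condMean (f : ℝ → ℝ) (s : Set ℝ) : ℝ :=
  (∫ x in s, x * f x) / (∫ x in s, f x)

/-- The bin (interval) of real numbers between two extended-real edges `lo` and `hi`. -/
def ebin (lo hi : EReal) : Set ℝ := {x : ℝ | lo ≤ (x : EReal) ∧ (x : EReal) < hi}

/-- Edges `m_0 = −∞ < m_1 < ⋯ < m_{N−1} < m_N = +∞` of an `N`-bin quantizer with interior
edges `m : Fin (N−1) → ℝ`, for a source with two-sided unbounded support. -/
noncomputable def edges2 (N : ℕ) (m : Fin (N - 1) → ℝ) (k : ℕ) : EReal :=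
  if hk : k = 0 then ⊥
  else if h : k ≤ N - 1 then ((m ⟨k - 1, by omega⟩ : ℝ) : EReal)
  else ⊤

/-- The best-response (Lloyd–Max) map: each interior edge is replaced by the midpoint of the
centroids of its two adjacent bins, shifted by the bias `b`:
`T_k(m) = (E[M | m_{k−1} ≤ M < m_k] + E[M | m_k ≤ M < m_{k+1}])/2 + b`. -/
noncomputable def lloydMap (f : ℝ → ℝ) (b : ℝ) (N : ℕ)
    (m : Fin (N - 1) → ℝ) : Fin (N - 1) → ℝ :=
  fun k =>
    (condMean f (ebin (edges2 N m k.val) (edges2 N m (k.val + 1)))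
      + condMean f (ebin (edges2 N m (k.val + 1)) (edges2 N m (k.val + 2)))) / 2 + b

/-- A positive, integrable, strictly log-concave function on `ℝ` with a finite first moment. -/
structure IsSLCDensity (f : ℝ → ℝ) : Prop where
  pos : ∀ x, 0 < f x
  integrable : Integrable f
  strictConcave : StrictConcaveOn ℝ Set.univ (fun x => Real.log (f x))
  integrable_mean : Integrable (fun x => x * f x)

/-! ### Conditional means over intervals -/

theorem measurableSet_ebin (lo hi : EReal) : MeasurableSet (ebin lo hi) :=
  measurable_coe_real_ereal measurableSet_Ico

theorem volume_ebin_pos {lo hi : EReal} (h : lo < hi) : 0 < volume (ebin lo hi) := by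
  obtain ⟨x, hx1, hx2⟩ := EReal.lt_iff_exists_real_btwn.1 h
  obtain ⟨y, hy1, hy2⟩ := EReal.lt_iff_exists_real_btwn.1 hx2
  have hxy : x < y := by exact_mod_cast hy1
  refine lt_of_lt_of_le ?_ (measure_mono (s := Ioo x y) ?_)
  · simpa using hxy
  · intro z hz
    exact ⟨hx1.le.trans (by exact_mod_cast hz.1.le), lt_trans (by exact_mod_cast hz.2) hy2⟩

theorem setIntegral_ebin_pos {h : ℝ → ℝ} {lo hi : EReal} (hlt : lo < hi) (c : ℝ)
    (hi_int : Integrable h) (h0 : ∀ x ∈ ebin lo hi, 0 ≤ h x)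
    (hp : ∀ x ∈ ebin lo hi, x ≠ c → 0 < h x) : 0 < ∫ x in ebin lo hi, h x := by
  rw [setIntegral_pos_iff_support_of_nonneg_ae _ hi_int.integrableOn]
  · have hsub : ebin lo hi \ {c} ⊆ Function.support h ∩ ebin lo hi := fun x hx =>
      ⟨(hp x hx.1 hx.2).ne', hx.1⟩
    refine lt_of_lt_of_le ?_ (measure_mono hsub)
    rw [measure_sdiff_null (measure_singleton c)]
    exact volume_ebin_pos hlt
  · exact (ae_restrict_iff' (measurableSet_ebin lo hi)).2 (Eventually.of_forall h0)

theorem setIntegral_ebin_add (F : ℝ → ℝ) (lo hi : EReal) (t : ℝ) :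
    ∫ x in ebin (lo + t) (hi + t), F x = ∫ x in ebin lo hi, F (x + t) := by
  rw [← integral_indicator (measurableSet_ebin _ _), ← integral_indicator (measurableSet_ebin _ _),
    ← integral_add_right_eq_self _ t]
  congr 1
  ext x
  have hmem : x + t ∈ ebin (lo + t) (hi + t) ↔ x ∈ ebin lo hi := by
    have e1 : lo + t ≤ ((x + t : ℝ) : EReal) ↔ lo ≤ x := by
      induction lo with
      | bot => simp
      | top => simp [-EReal.coe_add]
      | coe a => norm_cast; simp
    have e2 : ((x + t : ℝ) : EReal) < hi + t ↔ (x : EReal) < hi := by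
      induction hi with
      | bot => simp
      | top => simp [-EReal.coe_add, EReal.coe_lt_top]
      | coe a => norm_cast; simp
    exact and_congr e1 e2
  by_cases hx : x ∈ ebin lo hi
  · rw [indicator_of_mem (hmem.2 hx), indicator_of_mem hx]
  · rw [indicator_of_notMem (fun h => hx (hmem.1 h)), indicator_of_notMem hx]

theorem tendsto_setIntegral_ebin {F : ℝ → ℝ} (hF : Integrable F) {lo hi : EReal}
    {los his : ℕ → EReal} (hlo : Tendsto los atTop (nhds lo)) (hhi : Tendsto his atTop (nhds hi)) :
    Tendsto (fun n => ∫ x in ebin (los n) (his n), F x) atTop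
      (nhds (∫ x in ebin lo hi, F x)) := by
  simp_rw [← integral_indicator (measurableSet_ebin _ _)]
  refine tendsto_integral_of_dominated_convergence (fun x => ‖F x‖)
    (fun n => (hF.indicator (measurableSet_ebin _ _)).aestronglyMeasurable) hF.norm
    (fun n => Eventually.of_forall fun x => norm_indicator_le_norm_self _ _) ?_
  have hne : ∀ a : EReal, ∀ᵐ x : ℝ, (x : EReal) ≠ a := by
    intro a
    have hs : ({a.toReal} : Set ℝ)ᶜ ∈ ae (volume : Measure ℝ) :=
      compl_mem_ae_iff.2 (measure_singleton _)
    filter_upwards [hs] with x hx hxa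
    exact hx (by simp [← hxa])
  filter_upwards [hne lo, hne hi] with x hxlo hxhi
  refine tendsto_const_nhds.congr' ?_
  have h1 : ∀ᶠ n in atTop, (los n ≤ x ↔ lo ≤ x) := by
    rcases lt_or_gt_of_ne hxlo with h | h
    · filter_upwards [hlo.eventually (lt_mem_nhds h)] with n hn
      simp [not_le.2 hn, not_le.2 h]
    · filter_upwards [hlo.eventually (gt_mem_nhds h)] with n hn
      simp [hn.le, h.le]
  have h2 : ∀ᶠ n in atTop, ((x : EReal) < his n ↔ (x : EReal) < hi) := by
    rcases lt_or_gt_of_ne hxhi with h | h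
    · filter_upwards [hhi.eventually (lt_mem_nhds h)] with n hn
      simp [hn, h]
    · filter_upwards [hhi.eventually (gt_mem_nhds h)] with n hn
      simp [not_lt.2 hn.le, not_lt.2 h.le]
  filter_upwards [h1, h2] with n hn1 hn2
  have hmem : x ∈ ebin (los n) (his n) ↔ x ∈ ebin lo hi := and_congr hn1 hn2
  by_cases hx : x ∈ ebin lo hi
  · rw [indicator_of_mem (hmem.2 hx), indicator_of_mem hx]
  · rw [indicator_of_notMem (fun h => hx (hmem.1 h)), indicator_of_notMem hx]

namespace IsSLCDensity

variable {f : ℝ → ℝ}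

theorem integrable_sub_mul (hf : IsSLCDensity f) (a : ℝ) :
    Integrable (fun x => (x - a) * f x) := by
  simp only [sub_mul]
  exact hf.integrable_mean.sub (hf.integrable.const_mul a)

theorem mass_pos (hf : IsSLCDensity f) {lo hi : EReal} (h : lo < hi) :
    0 < ∫ x in ebin lo hi, f x :=
  setIntegral_ebin_pos h 0 hf.integrable (fun x _ => (hf.pos x).le) (fun x _ _ => hf.pos x)

theorem setIntegral_sub_mul (hf : IsSLCDensity f) {lo hi : EReal} (h : lo < hi) (a : ℝ) :
    ∫ x in ebin lo hi, (x - a) * f x =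
      (condMean f (ebin lo hi) - a) * ∫ x in ebin lo hi, f x := by
  have hm := (hf.mass_pos h).ne'
  simp_rw [sub_mul]
  rw [integral_sub hf.integrable_mean.integrableOn (hf.integrable.const_mul a).integrableOn,
    integral_const_mul]
  unfold condMean
  field_simp

theorem lt_condMean (hf : IsSLCDensity f) {lo hi : EReal} (h : lo < hi) :
    lo < condMean f (ebin lo hi) := by
  induction lo with
  | bot => exact EReal.bot_lt_coe _
  | top => exact absurd h (not_lt.2 le_top)
  | coe a =>
    have key : 0 < ∫ x in ebin a hi, (x - a) * f x := by
      have hge : ∀ x ∈ ebin (a : EReal) hi, a ≤ x := fun x hx => by exact_mod_cast hx.1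
      refine setIntegral_ebin_pos h a (hf.integrable_sub_mul a) (fun x hx => ?_) fun x hx hxa => ?_
      · exact mul_nonneg (sub_nonneg.2 (hge x hx)) (hf.pos x).le
      · exact mul_pos (sub_pos.2 (lt_of_le_of_ne (hge x hx) (Ne.symm hxa))) (hf.pos x)
    rw [hf.setIntegral_sub_mul h, mul_pos_iff_of_pos_right (hf.mass_pos h)] at key
    exact_mod_cast sub_pos.1 key

theorem condMean_lt (hf : IsSLCDensity f) {lo hi : EReal} (h : lo < hi) :
    (condMean f (ebin lo hi) : EReal) < hi := by
  induction hi with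
  | bot => exact absurd h (not_lt.2 bot_le)
  | top => exact EReal.coe_lt_top _
  | coe a =>
    have key : 0 < ∫ x in ebin lo a, -((x - a) * f x) := by
      have hlt : ∀ x ∈ ebin lo (a : EReal), x < a := fun x hx => by exact_mod_cast hx.2
      have hp : ∀ x ∈ ebin lo (a : EReal), 0 < -((x - a) * f x) := fun x hx =>
        neg_pos.2 (mul_neg_of_neg_of_pos (sub_neg.2 (hlt x hx)) (hf.pos x))
      exact setIntegral_ebin_pos h a (hf.integrable_sub_mul a).neg (fun x hx => (hp x hx).le)
        fun x hx _ => hp x hx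
    rw [integral_neg, hf.setIntegral_sub_mul h, ← neg_mul,
      mul_pos_iff_of_pos_right (hf.mass_pos h)] at key
    have : condMean f (ebin lo a) < a := by linarith
    exact_mod_cast this

theorem condMean_mono (hf : IsSLCDensity f) {lo hi lo' hi' : EReal} (h : lo < hi)
    (h' : lo' < hi') (hlo : lo ≤ lo') (hhi : hi ≤ hi') :
    condMean f (ebin lo hi) ≤ condMean f (ebin lo' hi') := by
  set c := condMean f (ebin lo hi) with hc
  rcases le_or_gt (c : EReal) lo' with hcl | hcl
  · exact_mod_cast (hcl.trans_lt (hf.lt_condMean h')).le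
  have hch : (c : EReal) < hi := hf.condMean_lt h
  have key : ∫ x in ebin lo hi, (x - c) * f x ≤ ∫ x in ebin lo' hi', (x - c) * f x := by
    rw [← integral_indicator (measurableSet_ebin _ _),
      ← integral_indicator (measurableSet_ebin _ _)]
    refine integral_mono ((hf.integrable_sub_mul c).indicator (measurableSet_ebin _ _))
      ((hf.integrable_sub_mul c).indicator (measurableSet_ebin _ _)) fun x => ?_
    have hfx := hf.pos x
    by_cases h1 : x ∈ ebin lo hi <;> by_cases h2 : x ∈ ebin lo' hi'
    · simp [h1, h2]
    · rw [indicator_of_mem h1, indicator_of_notMem h2]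
      have hx : (x : EReal) < lo' := by
        by_contra hcon
        exact h2 ⟨not_lt.1 hcon, h1.2.trans_le hhi⟩
      have : x < c := by exact_mod_cast hx.trans hcl
      exact mul_nonpos_of_nonpos_of_nonneg (by linarith) hfx.le
    · rw [indicator_of_mem h2, indicator_of_notMem h1]
      have hx : hi ≤ (x : EReal) := by
        by_contra hcon
        exact h1 ⟨hlo.trans h2.1, not_le.1 hcon⟩
      have : c < x := by exact_mod_cast hch.trans_le hx
      exact mul_nonneg (by linarith) hfx.le
    · simp [h1, h2]
  rw [hf.setIntegral_sub_mul h, hf.setIntegral_sub_mul h', ← hc, sub_self, zero_mul] at key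
  have := nonneg_of_mul_nonneg_left key (hf.mass_pos h')
  linarith

theorem mul_lt_mul_shift (hf : IsSLCDensity f) {x y t : ℝ} (hxy : x < y) (ht : 0 < t) :
    f x * f (y + t) < f (x + t) * f y := by
  have hd : 0 < y + t - x := by linarith
  have hne : x ≠ y + t := by linarith
  have ha : 0 < (y - x) / (y + t - x) := div_pos (by linarith) hd
  have hb : 0 < t / (y + t - x) := div_pos ht hd
  have hab : (y - x) / (y + t - x) + t / (y + t - x) = 1 := by field_simp; ring
  have h1 := hf.strictConcave.2 (mem_univ x) (mem_univ (y + t)) hne ha hb hab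
  have h2 := hf.strictConcave.2 (mem_univ x) (mem_univ (y + t)) hne hb ha (by linarith)
  simp only [smul_eq_mul] at h1 h2
  have e1 : (y - x) / (y + t - x) * x + t / (y + t - x) * (y + t) = x + t := by
    field_simp; ring
  have e2 : t / (y + t - x) * x + (y - x) / (y + t - x) * (y + t) = y := by
    field_simp; ring
  rw [e1] at h1
  rw [e2] at h2
  have hsum : Real.log (f x) + Real.log (f (y + t)) < Real.log (f (x + t)) + Real.log (f y) := by
    have : t / (y + t - x) = 1 - (y - x) / (y + t - x) := by linarith
    rw [this] at h1 h2
    linarith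
  rw [← Real.log_mul (hf.pos _).ne' (hf.pos _).ne',
    ← Real.log_mul (hf.pos _).ne' (hf.pos _).ne'] at hsum
  exact (Real.log_lt_log_iff (mul_pos (hf.pos _) (hf.pos _)) (mul_pos (hf.pos _) (hf.pos _))).1 hsum

theorem condMean_add_lt (hf : IsSLCDensity f) {lo hi : EReal} (h : lo < hi) {t : ℝ}
    (ht : 0 < t) :
    condMean f (ebin (lo + t) (hi + t)) < condMean f (ebin lo hi) + t := by
  have h' : lo + (t : EReal) < hi + t :=
    EReal.add_lt_add_of_lt_of_le h le_rfl (EReal.coe_ne_bot _) (EReal.coe_ne_top _)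
  set c := condMean f (ebin lo hi) with hc
  have e1 : ∫ x in ebin lo hi, (x - c) * f (x + t) =
      (condMean f (ebin (lo + t) (hi + t)) - (c + t)) * ∫ x in ebin (lo + t) (hi + t), f x := by
    rw [← hf.setIntegral_sub_mul h', setIntegral_ebin_add (fun x => (x - (c + t)) * f x)]
    simp only [add_sub_add_right_eq_sub]
  have hi1 : Integrable (fun x => (x - c) * f (x + t)) := by
    simpa only [add_sub_add_right_eq_sub] using (hf.integrable_sub_mul (c + t)).comp_add_right t
  have hi2 : Integrable (fun x => f (c + t) / f c * ((x - c) * f x)) :=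
    (hf.integrable_sub_mul c).const_mul _
  have hfc := hf.pos c
  have hp : ∀ x, x ≠ c → 0 < f (c + t) / f c * ((x - c) * f x) - (x - c) * f (x + t) := by
    intro x hx
    have e : f (c + t) / f c * ((x - c) * f x) - (x - c) * f (x + t) =
        (x - c) * (f (c + t) * f x - f c * f (x + t)) / f c := by
      field_simp
    rw [e]
    refine div_pos ?_ hfc
    rcases lt_or_gt_of_ne hx with hlt | hgt
    · have := hf.mul_lt_mul_shift hlt ht
      exact mul_pos_of_neg_of_neg (by linarith) (by linarith)
    · have := hf.mul_lt_mul_shift hgt ht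
      exact mul_pos (by linarith) (by linarith)
  have key : 0 < ∫ x in ebin lo hi,
      (f (c + t) / f c * ((x - c) * f x) - (x - c) * f (x + t)) := by
    refine setIntegral_ebin_pos h c (hi2.sub hi1) (fun x _ => ?_) fun x _ hx => hp x hx
    rcases eq_or_ne x c with rfl | hx
    · simp
    · exact (hp x hx).le
  rw [integral_sub hi2.integrableOn hi1.integrableOn, integral_const_mul,
    hf.setIntegral_sub_mul h, ← hc, e1, sub_self, zero_mul, mul_zero, zero_sub, ← neg_mul,
    mul_pos_iff_of_pos_right (hf.mass_pos h')] at key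
  linarith

theorem condMean_add_le (hf : IsSLCDensity f) {lo hi : EReal} (h : lo < hi) {t : ℝ}
    (ht : 0 ≤ t) :
    condMean f (ebin (lo + t) (hi + t)) ≤ condMean f (ebin lo hi) + t := by
  rcases ht.eq_or_lt with rfl | ht
  · simp
  · exact (hf.condMean_add_lt h ht).le

theorem tendsto_condMean (hf : IsSLCDensity f) {lo hi : EReal} (h : lo < hi)
    {los his : ℕ → EReal} (hlo : Tendsto los atTop (nhds lo)) (hhi : Tendsto his atTop (nhds hi)) :
    Tendsto (fun n => condMean f (ebin (los n) (his n))) atTop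
      (nhds (condMean f (ebin lo hi))) :=
  (tendsto_setIntegral_ebin hf.integrable_mean hlo hhi).div
    (tendsto_setIntegral_ebin hf.integrable hlo hhi) (hf.mass_pos h).ne'

end IsSLCDensity

/-! ### Edges of a quantizer -/

section Edges

variable {N : ℕ}

theorem edges2_zero (m : Fin (N - 1) → ℝ) : edges2 N m 0 = ⊥ := by simp [edges2]

theorem edges2_succ (m : Fin (N - 1) → ℝ) (i : Fin (N - 1)) :
    edges2 N m (i + 1) = (m i : EReal) := by
  have : (i : ℕ) + 1 ≤ N - 1 := i.2
  simp [edges2, this]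

theorem edges2_top (m : Fin (N - 1) → ℝ) {k : ℕ} (hk : N - 1 < k) : edges2 N m k = ⊤ := by
  have h0 : k ≠ 0 := by omega
  simp [edges2, h0, not_le.2 hk]

theorem edge_index_cases (N k : ℕ) :
    k = 0 ∨ (∃ i : Fin (N - 1), k = i + 1) ∨ N - 1 < k := by
  rcases Nat.eq_zero_or_pos k with h | h
  · exact Or.inl h
  · by_cases hk : N - 1 < k
    · exact Or.inr (Or.inr hk)
    · exact Or.inr (Or.inl ⟨⟨k - 1, by omega⟩, by simp; omega⟩)

theorem edges2_le_edges2 {m m' : Fin (N - 1) → ℝ} (h : m ≤ m') (k : ℕ) :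
    edges2 N m k ≤ edges2 N m' k := by
  rcases edge_index_cases N k with rfl | ⟨i, rfl⟩ | hk
  · simp [edges2_zero]
  · rw [edges2_succ, edges2_succ]
    exact_mod_cast h i
  · simp [edges2_top _ hk]

theorem edges2_add_const (m : Fin (N - 1) → ℝ) (t : ℝ) (k : ℕ) :
    edges2 N (fun i => m i + t) k = edges2 N m k + t := by
  rcases edge_index_cases N k with rfl | ⟨i, rfl⟩ | hk
  · simp [edges2_zero]
  · rw [edges2_succ, edges2_succ]
    norm_cast
  · simp [edges2_top _ hk]

theorem tendsto_edges2 {v : ℕ → Fin (N - 1) → ℝ} {p : Fin (N - 1) → ℝ}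
    (h : Tendsto v atTop (nhds p)) (k : ℕ) :
    Tendsto (fun n => edges2 N (v n) k) atTop (nhds (edges2 N p k)) := by
  rcases edge_index_cases N k with rfl | ⟨i, rfl⟩ | hk
  · simp [edges2_zero]
  · simp_rw [edges2_succ]
    exact (continuous_coe_real_ereal.tendsto _).comp ((tendsto_pi_nhds.1 h) i)
  · simp [edges2_top _ hk]

theorem edges2_lt_succ (hN : 2 ≤ N) {m : Fin (N - 1) → ℝ} (hm : StrictMono m) {k : ℕ}
    (hk : k < N) : edges2 N m k < edges2 N m (k + 1) := by
  rcases edge_index_cases N k with rfl | ⟨i, rfl⟩ | hk'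
  · have := edges2_succ m ⟨0, by omega⟩
    simp only at this
    rw [edges2_zero, this]
    exact EReal.bot_lt_coe _
  · rw [edges2_succ]
    rcases edge_index_cases N (i + 1 + 1) with h0 | ⟨j, hj⟩ | htop
    · omega
    · rw [hj, edges2_succ]
      have : i < j := by rw [Fin.lt_def]; omega
      exact_mod_cast hm this
    · rw [edges2_top _ htop]
      exact EReal.coe_lt_top _
  · rw [edges2_top m (k := k + 1) (by omega)]
    omega

theorem strictMono_of_edges2_lt {m : Fin (N - 1) → ℝ}
    (h : ∀ k < N, edges2 N m k < edges2 N m (k + 1)) : StrictMono m := by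
  have hmono : ∀ a b : ℕ, a < b → b ≤ N → edges2 N m a < edges2 N m b := by
    intro a b hab
    induction b, hab using Nat.le_induction with
    | base => exact fun hb => h a (by omega)
    | succ n hn ih => exact fun hb => (ih (by omega)).trans (h n (by omega))
  intro i j hij
  have hj := j.2
  have := hmono (i + 1) (j + 1) (by rw [Fin.lt_def] at hij; omega) (by omega)
  rw [edges2_succ, edges2_succ] at this
  exact_mod_cast this

end Edges

/-! ### The Lloyd–Max map -/

/-- The centroid of the `k`-th bin of the quantizer with edges `m`. -/
noncomputable def binMean (f : ℝ → ℝ) (N : ℕ) (m : Fin (N - 1) → ℝ) (k : ℕ) : ℝ :=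
  condMean f (ebin (edges2 N m k) (edges2 N m (k + 1)))

theorem lloydMap_apply (f : ℝ → ℝ) (b : ℝ) (N : ℕ) (m : Fin (N - 1) → ℝ) (k : Fin (N - 1)) :
    lloydMap f b N m k = (binMean f N m k + binMean f N m (k + 1)) / 2 + b := rfl

namespace IsSLCDensity

variable {f : ℝ → ℝ} {N : ℕ}

theorem edges2_lt_binMean (hf : IsSLCDensity f) (hN : 2 ≤ N) {m : Fin (N - 1) → ℝ}
    (hm : StrictMono m) {k : ℕ} (hk : k < N) : edges2 N m k < binMean f N m k :=
  hf.lt_condMean (edges2_lt_succ hN hm hk)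

theorem binMean_lt_edges2 (hf : IsSLCDensity f) (hN : 2 ≤ N) {m : Fin (N - 1) → ℝ}
    (hm : StrictMono m) {k : ℕ} (hk : k < N) :
    (binMean f N m k : EReal) < edges2 N m (k + 1) :=
  hf.condMean_lt (edges2_lt_succ hN hm hk)

theorem binMean_lt_succ (hf : IsSLCDensity f) (hN : 2 ≤ N) {m : Fin (N - 1) → ℝ}
    (hm : StrictMono m) {k : ℕ} (hk : k + 1 < N) : binMean f N m k < binMean f N m (k + 1) := by
  exact_mod_cast (hf.binMean_lt_edges2 hN hm (by omega)).trans (hf.edges2_lt_binMean hN hm hk)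

theorem binMean_lt_binMean (hf : IsSLCDensity f) (hN : 2 ≤ N) {m : Fin (N - 1) → ℝ}
    (hm : StrictMono m) {k l : ℕ} (hkl : k < l) (hl : l < N) :
    binMean f N m k < binMean f N m l := by
  induction l, hkl using Nat.le_induction with
  | base => exact hf.binMean_lt_succ hN hm hl
  | succ n hn ih => exact (ih (by omega)).trans (hf.binMean_lt_succ hN hm hl)

theorem strictMono_lloydMap (hf : IsSLCDensity f) (b : ℝ) (hN : 2 ≤ N) {m : Fin (N - 1) → ℝ}
    (hm : StrictMono m) : StrictMono (lloydMap f b N m) := by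
  intro i j hij
  have hj := j.2
  rw [Fin.lt_def] at hij
  rw [lloydMap_apply, lloydMap_apply]
  have h1 := hf.binMean_lt_binMean hN hm (k := i) (l := j) hij (by omega)
  have h2 := hf.binMean_lt_binMean hN hm (k := i + 1) (l := j + 1) (by omega) (by omega)
  linarith

theorem lloydMap_mono (hf : IsSLCDensity f) (b : ℝ) (hN : 2 ≤ N) {m m' : Fin (N - 1) → ℝ}
    (hm : StrictMono m) (hm' : StrictMono m') (h : m ≤ m') :
    lloydMap f b N m ≤ lloydMap f b N m' := by
  intro i
  have key : ∀ k < N, binMean f N m k ≤ binMean f N m' k := fun k hk =>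
    hf.condMean_mono (edges2_lt_succ hN hm hk) (edges2_lt_succ hN hm' hk)
      (edges2_le_edges2 h _) (edges2_le_edges2 h _)
  rw [lloydMap_apply, lloydMap_apply]
  have hi := i.2
  linarith [key i (by omega), key (i + 1) (by omega)]

theorem lloydMap_add_const_lt (hf : IsSLCDensity f) (b : ℝ) (hN : 2 ≤ N) {m : Fin (N - 1) → ℝ}
    (hm : StrictMono m) {t : ℝ} (ht : 0 < t) (i : Fin (N - 1)) :
    lloydMap f b N (fun j => m j + t) i < lloydMap f b N m i + t := by
  have key : ∀ k < N, binMean f N (fun j => m j + t) k < binMean f N m k + t := fun k hk => by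
    unfold binMean
    rw [edges2_add_const, edges2_add_const]
    exact hf.condMean_add_lt (edges2_lt_succ hN hm hk) ht
  rw [lloydMap_apply, lloydMap_apply]
  have hi := i.2
  linarith [key i (by omega), key (i + 1) (by omega)]

theorem lloydMap_add_const_le (hf : IsSLCDensity f) (b : ℝ) (hN : 2 ≤ N) {m : Fin (N - 1) → ℝ}
    (hm : StrictMono m) {t : ℝ} (ht : 0 ≤ t) (i : Fin (N - 1)) :
    lloydMap f b N (fun j => m j + t) i ≤ lloydMap f b N m i + t := by
  rcases ht.eq_or_lt with rfl | ht
  · simp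
  · exact (hf.lloydMap_add_const_lt b hN hm ht i).le

theorem le_of_fixed (hf : IsSLCDensity f) (b : ℝ) (hN : 2 ≤ N) {m m' : Fin (N - 1) → ℝ}
    (hm : StrictMono m) (hm' : StrictMono m') (hfix : lloydMap f b N m = m)
    (hfix' : lloydMap f b N m' = m') : m ≤ m' := by
  have : Nonempty (Fin (N - 1)) := ⟨⟨0, by omega⟩⟩
  obtain ⟨i, hi⟩ := Finite.exists_max fun j => m j - m' j
  by_contra hcon
  have ht : 0 < m i - m' i := by
    by_contra hle
    exact hcon fun j => by linarith [hi j]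
  have hle : m ≤ fun j => m' j + (m i - m' i) := fun j => by linarith [hi j]
  have hsm : StrictMono fun j => m' j + (m i - m' i) := hm'.add_const _
  have h1 := hf.lloydMap_mono b hN hm hsm hle i
  have h2 := hf.lloydMap_add_const_lt b hN hm' ht i
  rw [hfix] at h1
  rw [hfix'] at h2
  linarith

theorem strictMono_iterate (hf : IsSLCDensity f) (b : ℝ) (hN : 2 ≤ N) {m : Fin (N - 1) → ℝ}
    (hm : StrictMono m) (n : ℕ) : StrictMono ((lloydMap f b N)^[n] m) := by
  induction n with
  | zero => exact hm
  | succ n ih =>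
    rw [Function.iterate_succ_apply']
    exact hf.strictMono_lloydMap b hN ih

theorem iterate_mono (hf : IsSLCDensity f) (b : ℝ) (hN : 2 ≤ N) {m m' : Fin (N - 1) → ℝ}
    (hm : StrictMono m) (hm' : StrictMono m') (h : m ≤ m') (n : ℕ) :
    (lloydMap f b N)^[n] m ≤ (lloydMap f b N)^[n] m' := by
  induction n with
  | zero => exact h
  | succ n ih =>
    rw [Function.iterate_succ_apply', Function.iterate_succ_apply']
    exact hf.lloydMap_mono b hN (hf.strictMono_iterate b hN hm n)
      (hf.strictMono_iterate b hN hm' n) ih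

/-- Along a convergent sequence of quantizers, the centroids of a bin converge even if the bin
degenerates to a point in the limit. -/
theorem exists_tendsto_binMean (hf : IsSLCDensity f) (hN : 2 ≤ N) {v : ℕ → Fin (N - 1) → ℝ}
    {p : Fin (N - 1) → ℝ} (hv : ∀ n, StrictMono (v n)) (hp : Tendsto v atTop (nhds p)) {k : ℕ}
    (hk : k < N) :
    ∃ G : ℝ, Tendsto (fun n => binMean f N (v n) k) atTop (nhds G) ∧
      ((edges2 N p k < edges2 N p (k + 1) ∧ G = binMean f N p k ∧ edges2 N p k < G ∧
          (G : EReal) < edges2 N p (k + 1)) ∨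
        (edges2 N p k = G ∧ edges2 N p (k + 1) = G)) := by
  have hlo := tendsto_edges2 hp k
  have hhi := tendsto_edges2 hp (k + 1)
  have hle : edges2 N p k ≤ edges2 N p (k + 1) :=
    le_of_tendsto_of_tendsto' hlo hhi fun n => (edges2_lt_succ hN (hv n) hk).le
  rcases hle.lt_or_eq with hlt | heq
  · exact ⟨_, hf.tendsto_condMean hlt hlo hhi,
      Or.inl ⟨hlt, rfl, hf.lt_condMean hlt, hf.condMean_lt hlt⟩⟩
  · have hreal : ∃ r : ℝ, edges2 N p k = r := by
      rcases edge_index_cases N k with rfl | ⟨i, rfl⟩ | hk'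
      · have := edges2_succ p ⟨0, by omega⟩
        simp only at this
        rw [edges2_zero, this] at heq
        exact absurd heq (EReal.bot_ne_coe _)
      · exact ⟨_, edges2_succ p i⟩
      · omega
    obtain ⟨r, hr⟩ := hreal
    rw [← heq] at hhi
    have hsq := tendsto_of_tendsto_of_tendsto_of_le_of_le hlo hhi
      (fun n => (hf.edges2_lt_binMean hN (hv n) hk).le)
      (fun n => (hf.binMean_lt_edges2 hN (hv n) hk).le)
    rw [hr] at hsq
    exact ⟨r, EReal.tendsto_coe.1 hsq, Or.inr ⟨hr, heq ▸ hr⟩⟩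

theorem fixed_of_tendsto (hf : IsSLCDensity f) (b : ℝ) (hN : 2 ≤ N) {u p : Fin (N - 1) → ℝ}
    (hu : StrictMono u) (hp : Tendsto (fun n => (lloydMap f b N)^[n] u) atTop (nhds p)) :
    StrictMono p ∧ lloydMap f b N p = p := by
  have hbin := fun (k : ℕ) (hk : k < N) =>
    hf.exists_tendsto_binMean hN (hf.strictMono_iterate b hN hu) hp hk
  choose! G hG hGp using hbin
  have heq : ∀ i : Fin (N - 1), p i = (G i + G (i + 1)) / 2 + b := by
    intro i
    have hi := i.2
    have h1 := (tendsto_pi_nhds.1 ((tendsto_add_atTop_iff_nat 1).2 hp)) i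
    have h2 := (((hG i (by omega)).add (hG (i + 1) (by omega))).div_const 2).add_const b
    refine tendsto_nhds_unique h1 (h2.congr fun n => ?_)
    rw [Function.iterate_succ_apply', lloydMap_apply]
  have hdeg : ∀ j < N, ¬ (edges2 N p j = G j ∧ edges2 N p (j + 1) = G j) := by
    rcases le_total 0 b with hb | hb
    · have key : ∀ d j : ℕ, j + d + 1 = N →
          ¬ (edges2 N p j = G j ∧ edges2 N p (j + 1) = G j) := by
        intro d
        induction d with
        | zero =>
          rintro j hj ⟨-, h⟩
          rw [edges2_top p (by omega)] at h
          exact EReal.top_ne_coe _ h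
        | succ d ih =>
          rintro j hj ⟨-, h⟩
          have hi : j < N - 1 := by omega
          have hp' := heq ⟨j, hi⟩
          have he := edges2_succ p ⟨j, hi⟩
          simp only at he hp'
          have hpG : p ⟨j, hi⟩ = G j := by
            rw [he] at h
            exact_mod_cast h
          have hle : G (j + 1) ≤ G j := by linarith
          rcases hGp (j + 1) (by omega) with ⟨-, -, h3, -⟩ | h3
          · rw [h] at h3
            exact absurd (EReal.coe_lt_coe_iff.1 h3) (not_lt.2 hle)
          · exact ih (j + 1) (by omega) h3
      exact fun j hj => key (N - 1 - j) j (by omega)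
    · intro j
      induction j with
      | zero =>
        rintro - ⟨h, -⟩
        rw [edges2_zero] at h
        exact EReal.bot_ne_coe _ h
      | succ j ih =>
        rintro hj ⟨h, -⟩
        have hi : j < N - 1 := by omega
        have hp' := heq ⟨j, hi⟩
        have he := edges2_succ p ⟨j, hi⟩
        simp only at he hp'
        have hpG : p ⟨j, hi⟩ = G (j + 1) := by
          rw [he] at h
          exact_mod_cast h
        have hle : G (j + 1) ≤ G j := by linarith
        rcases hGp j (by omega) with ⟨-, -, -, h3⟩ | h3
        · rw [h] at h3
          exact absurd (EReal.coe_lt_coe_iff.1 h3) (not_lt.2 hle)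
        · exact ih (by omega) h3
  have hnd := fun k (hk : k < N) => (hGp k hk).resolve_right (hdeg k hk)
  refine ⟨strictMono_of_edges2_lt fun k hk => (hnd k hk).1, funext fun i => ?_⟩
  have hi := i.2
  rw [lloydMap_apply, ← (hnd i (by omega)).2.1, ← (hnd (i + 1) (by omega)).2.1, ← heq i]

theorem exists_supersolution (hf : IsSLCDensity f) (b : ℝ) (hN : 2 ≤ N) :
    ∃ w : Fin (N - 1) → ℝ, StrictMono w ∧ lloydMap f b N w ≤ w := by
  have h0top : ((0 : ℝ) : EReal) < ⊤ := EReal.coe_lt_top _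
  set C := condMean f (ebin ((0 : ℝ) : EReal) ⊤) with hC
  have hCpos : 0 < C := by exact_mod_cast hf.lt_condMean h0top
  set L := 2 * (C + |b|) with hL
  have hLpos : 0 < L := by positivity
  set A := max 0 (condMean f (ebin ⊥ ⊤) + L - C) with hA
  have hA0 : 0 ≤ A := le_max_left _ _
  have hA1 : condMean f (ebin ⊥ ⊤) + L - C ≤ A := le_max_right _ _
  let w : Fin (N - 1) → ℝ := fun i => A + (i : ℕ) * L
  have hw : StrictMono w := by
    intro i j hij
    have : ((i : ℕ) : ℝ) < (j : ℕ) := by exact_mod_cast hij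
    simp only [w]
    nlinarith
  have hw0 : ∀ i, 0 ≤ w i := fun i => by simp only [w]; positivity
  have hup : ∀ i : Fin (N - 1), binMean f N w (i + 1) ≤ w i + C := by
    intro i
    have hi := i.2
    have h1 : binMean f N w (i + 1) ≤ condMean f (ebin (w i : EReal) ⊤) :=
      hf.condMean_mono (edges2_lt_succ hN hw (by omega)) (EReal.coe_lt_top _)
        (edges2_succ w i).le le_top
    have h2 := hf.condMean_add_le h0top (hw0 i)
    rw [EReal.top_add_coe, EReal.coe_zero, zero_add] at h2
    simp only [EReal.coe_zero] at hC
    linarith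
  have hlow : ∀ i : Fin (N - 1), binMean f N w i ≤ w i - L + C := by
    rintro ⟨i, hi⟩
    cases i with
    | zero =>
      have h1 : binMean f N w 0 ≤ condMean f (ebin ⊥ ⊤) :=
        hf.condMean_mono (edges2_lt_succ hN hw (by omega)) bot_lt_top bot_le le_top
      simp only [w, Nat.cast_zero, zero_mul]
      linarith
    | succ i =>
      have h1 := hup ⟨i, by omega⟩
      simp only [w] at h1 ⊢
      push_cast
      linarith
  refine ⟨w, hw, fun i => ?_⟩
  rw [lloydMap_apply]
  linarith [hup i, hlow i, le_abs_self b]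

theorem exists_subsolution (hf : IsSLCDensity f) (b : ℝ) (hN : 2 ≤ N) :
    ∃ u : Fin (N - 1) → ℝ, StrictMono u ∧ u ≤ lloydMap f b N u := by
  have hbot0 : ⊥ < ((0 : ℝ) : EReal) := EReal.bot_lt_coe _
  set C := -condMean f (ebin ⊥ ((0 : ℝ) : EReal)) with hC
  have hCpos : 0 < C := by
    have : condMean f (ebin ⊥ ((0 : ℝ) : EReal)) < 0 := by exact_mod_cast hf.condMean_lt hbot0
    linarith
  set L := 2 * (C + |b|) with hL
  have hLpos : 0 < L := by positivity
  set A := max 0 (-condMean f (ebin ⊥ ⊤) + L - C) with hA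
  have hA0 : 0 ≤ A := le_max_left _ _
  have hA1 : -condMean f (ebin ⊥ ⊤) + L - C ≤ A := le_max_right _ _
  let u : Fin (N - 1) → ℝ := fun i => -A + ((i : ℕ) - ((N - 2 : ℕ) : ℝ)) * L
  have hu : StrictMono u := by
    intro i j hij
    have : ((i : ℕ) : ℝ) < (j : ℕ) := by exact_mod_cast hij
    simp only [u]
    nlinarith
  have hu0 : ∀ i, u i ≤ 0 := fun i => by
    have hi := i.2
    have : ((i : ℕ) : ℝ) ≤ ((N - 2 : ℕ) : ℝ) := by exact_mod_cast (by omega : (i : ℕ) ≤ N - 2)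
    simp only [u]
    nlinarith
  have hlow : ∀ i : Fin (N - 1), u i - C ≤ binMean f N u i := by
    intro i
    have hi := i.2
    have h1 : condMean f (ebin ⊥ (u i : EReal)) ≤ binMean f N u i :=
      hf.condMean_mono (EReal.bot_lt_coe _) (edges2_lt_succ hN hu (by omega))
        bot_le (edges2_succ u i).ge
    have h2 := hf.condMean_add_le (EReal.bot_lt_coe (u i)) (neg_nonneg.2 (hu0 i))
    rw [EReal.bot_add, ← EReal.coe_add, add_neg_cancel] at h2
    linarith
  have hup : ∀ i : Fin (N - 1), u i + L - C ≤ binMean f N u (i + 1) := by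
    intro i
    have hi := i.2
    by_cases hi' : (i : ℕ) + 1 < N - 1
    · have h1 := hlow ⟨i + 1, hi'⟩
      simp only [u] at h1 ⊢
      push_cast at h1
      linarith
    · have h1 : condMean f (ebin ⊥ ⊤) ≤ binMean f N u (i + 1) :=
        hf.condMean_mono bot_lt_top (edges2_lt_succ hN hu (by omega)) bot_le
          (edges2_top u (by omega)).ge
      have hui : u i = -A := by
        have : (i : ℕ) = N - 2 := by omega
        simp [u, this]
      linarith
  refine ⟨u, hu, fun i => ?_⟩
  rw [lloydMap_apply]
  linarith [hup i, hlow i, neg_abs_le b]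

theorem exists_tendsto_fixed (hf : IsSLCDensity f) (b : ℝ) (hN : 2 ≤ N) {m : Fin (N - 1) → ℝ}
    (hm : StrictMono m) :
    ∃ p : Fin (N - 1) → ℝ, StrictMono p ∧ lloydMap f b N p = p ∧
      Tendsto (fun n => (lloydMap f b N)^[n] m) atTop (nhds p) := by
  obtain ⟨u₀, hu₀, hu₀T⟩ := hf.exists_subsolution b hN
  obtain ⟨w₀, hw₀, hw₀T⟩ := hf.exists_supersolution b hN
  set s := ‖u₀ - m‖ + ‖m - w₀‖ with hs
  have hs0 : 0 ≤ s := by positivity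
  have hb1 : ∀ i, u₀ i - m i ≤ s := fun i => by
    have := (le_abs_self _).trans (norm_le_pi_norm (u₀ - m) i)
    simp only [Pi.sub_apply] at this
    linarith [norm_nonneg (m - w₀)]
  have hb2 : ∀ i, m i - w₀ i ≤ s := fun i => by
    have := (le_abs_self _).trans (norm_le_pi_norm (m - w₀) i)
    simp only [Pi.sub_apply] at this
    linarith [norm_nonneg (u₀ - m)]
  let u : Fin (N - 1) → ℝ := fun i => u₀ i + -s
  let w : Fin (N - 1) → ℝ := fun i => w₀ i + s
  have hu : StrictMono u := hu₀.add_const _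
  have hw : StrictMono w := hw₀.add_const _
  have hum : u ≤ m := fun i => by simp only [u]; linarith [hb1 i]
  have hmw : m ≤ w := fun i => by simp only [w]; linarith [hb2 i]
  have huT : u ≤ lloydMap f b N u := fun i => by
    have h1 := hf.lloydMap_add_const_le b hN hu hs0 i
    have h2 : (fun j => u j + s) = u₀ := by ext j; simp [u]
    rw [h2] at h1
    have := hu₀T i
    simp only [u] at h1 ⊢
    linarith
  have hwT : lloydMap f b N w ≤ w := fun i => by
    have h1 := hf.lloydMap_add_const_le b hN hw₀ hs0 i
    have := hw₀T i
    simp only [w]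
    linarith
  have hle := fun n => hf.iterate_mono b hN hu hm hum n
  have hge := fun n => hf.iterate_mono b hN hm hw hmw n
  have humono : Monotone fun n => (lloydMap f b N)^[n] u := monotone_nat_of_le_succ fun n => by
    rw [Function.iterate_succ_apply]
    exact hf.iterate_mono b hN hu (hf.strictMono_lloydMap b hN hu) huT n
  have hwanti : Antitone fun n => (lloydMap f b N)^[n] w := antitone_nat_of_succ_le fun n => by
    rw [Function.iterate_succ_apply]
    exact hf.iterate_mono b hN (hf.strictMono_lloydMap b hN hw) hw hwT n
  have hp : Tendsto (fun n => (lloydMap f b N)^[n] u) atTop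
      (nhds (⨆ n, (lloydMap f b N)^[n] u)) := by
    refine tendsto_atTop_ciSup humono ⟨w, ?_⟩
    rintro _ ⟨n, rfl⟩
    exact ((hle n).trans (hge n)).trans (hwanti (Nat.zero_le n))
  have hq : Tendsto (fun n => (lloydMap f b N)^[n] w) atTop
      (nhds (⨅ n, (lloydMap f b N)^[n] w)) := by
    refine tendsto_atTop_ciInf hwanti ⟨u, ?_⟩
    rintro _ ⟨n, rfl⟩
    exact (humono (Nat.zero_le n)).trans ((hle n).trans (hge n))
  obtain ⟨hp1, hp2⟩ := hf.fixed_of_tendsto b hN hu hp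
  obtain ⟨hq1, hq2⟩ := hf.fixed_of_tendsto b hN hw hq
  rw [(hf.le_of_fixed b hN hq1 hp1 hq2 hp2).antisymm (hf.le_of_fixed b hN hp1 hq1 hp2 hq2)] at hq
  refine ⟨_, hp1, hp2, tendsto_pi_nhds.2 fun i => ?_⟩
  exact tendsto_of_tendsto_of_tendsto_of_le_of_le (tendsto_pi_nhds.1 hp i)
    (tendsto_pi_nhds.1 hq i) (fun n => hle n i) (fun n => hge n i)

end IsSLCDensity

/-- For an everywhere positive, strictly log-concave density with finite
mean and any bias `b`, the Lloyd–Max best-response map `T` maps the set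
`D = {m : m_1 < ⋯ < m_{N−1}}` into itself, has a unique fixed point `m*` in `D`, and the
iterates `T^n(m)` converge to `m*` (in the sup norm, i.e. in `Fin (N−1) → ℝ`) for every
starting point `m ∈ D`. -/
theorem lloydMax_converges (f : ℝ → ℝ) (b : ℝ) (N : ℕ) (hN : 2 ≤ N)
    (hpos : ∀ x, 0 < f x)
    (hint : Integrable f)
    (hpdf : ∫ x, f x = 1)
    (hslc : StrictConcaveOn ℝ Set.univ (fun x => Real.log (f x)))
    (hmean : Integrable (fun x => x * f x)) :
    (∀ m : Fin (N - 1) → ℝ, StrictMono m → StrictMono (lloydMap f b N m)) ∧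
    ∃ mstar : Fin (N - 1) → ℝ, StrictMono mstar ∧ lloydMap f b N mstar = mstar ∧
      (∀ m : Fin (N - 1) → ℝ, StrictMono m → lloydMap f b N m = m → m = mstar) ∧
      (∀ m : Fin (N - 1) → ℝ, StrictMono m →
        Tendsto (fun n : ℕ => (lloydMap f b N)^[n] m) atTop (nhds mstar)) := by
  have hf : IsSLCDensity f := ⟨hpos, hint, hslc, hmean⟩
  refine ⟨fun m hm => hf.strictMono_lloydMap b hN hm, ?_⟩
  obtain ⟨u, hu, -⟩ := hf.exists_subsolution b hN
  obtain ⟨p, hp, hpT, -⟩ := hf.exists_tendsto_fixed b hN hu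
  have huniq : ∀ m : Fin (N - 1) → ℝ, StrictMono m → lloydMap f b N m = m → m = p :=
    fun m hm hmT =>
      (hf.le_of_fixed b hN hm hp hmT hpT).antisymm (hf.le_of_fixed b hN hp hm hpT hmT)
  refine ⟨p, hp, hpT, huniq, fun m hm => ?_⟩
  obtain ⟨q, hq, hqT, hlim⟩ := hf.exists_tendsto_fixed b hN hm
  rwa [← huniq q hq hqT]
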